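/- arXiv:2007.01463 — 3 statements merged into one kernel-verified Lean document; each statement's English description precedes it below -/
import Mathlib

section
/- Let ρ > 0, k ∈ (0,1), and γ ∈ (0, kρ/(kρ+1)). Let π be any stationary distribution of the full flexibility system and p any stationary distribution of the partial flexibility system, both with parameters (ρ, k, γ). Then T_fs(π) < T_ps(p) < T_is, where T_is = ρ/(ρ+1) + kρ/(kρ+1). (In particular, the independent system is optimal on this parameter range.) -/
/-- The balance equations of the full flexibility system with parameters `ρ`, `k`, `γ`. -/
def FullBalance (ρ k γ : ℝ) (π : Fin 3 → Fin 3 → ℝ) : Prop :=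
  (ρ + k*ρ) * π 0 0 = π 1 0 + γ * π 0 1 + π 0 2 + γ * π 2 0 ∧
  (ρ + k*ρ + 1) * π 1 0 = ρ * π 0 0 + γ * π 1 1 + π 1 2 ∧
  (ρ + k*ρ + γ) * π 2 0 = γ * π 2 1 + π 2 2 ∧
  (ρ + k*ρ + γ) * π 0 1 = π 1 1 + γ * π 2 1 ∧
  (1 + γ) * π 1 1 = ρ * π 1 0 + ρ * π 0 1 ∧
  2 * γ * π 2 1 = ρ * π 2 0 + k*ρ * π 0 1 ∧
  (ρ + k*ρ + 1) * π 0 2 = k*ρ * π 0 0 + π 1 2 + γ * π 2 2 ∧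
  2 * π 1 2 = ρ * π 0 2 + k*ρ * π 1 0 ∧
  (γ + 1) * π 2 2 = k*ρ * π 2 0 + k*ρ * π 0 2

/-- `π` is a stationary distribution of the full flexibility system. -/
def FullStationary (ρ k γ : ℝ) (π : Fin 3 → Fin 3 → ℝ) : Prop :=
  (∀ i j, 0 ≤ π i j) ∧ (∑ i : Fin 3, ∑ j : Fin 3, π i j) = 1 ∧ FullBalance ρ k γ π

/-- Throughput of the full flexibility system. -/
noncomputable def Tfs (ρ k : ℝ) (π : Fin 3 → Fin 3 → ℝ) : ℝ :=
  (k + 1) * ρ * (1 - π 1 1 - π 1 2 - π 2 1 - π 2 2)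

/-- The balance equations of the partial flexibility system with parameters `ρ`, `k`, `γ`. -/
def PartialBalance (ρ k γ : ℝ) (p : Fin 2 → Fin 3 → ℝ) : Prop :=
  (ρ + k*ρ) * p 0 0 = p 1 0 + γ * p 0 1 + p 0 2 ∧
  (ρ + k*ρ + 1) * p 1 0 = ρ * p 0 0 + γ * p 1 1 + p 1 2 ∧
  2 * p 1 2 = ρ * p 0 2 + k*ρ * p 1 0 ∧
  (ρ + 1) * p 0 2 = k*ρ * p 0 0 + p 1 2 ∧
  (1 + γ) * p 1 1 = ρ * (p 0 1 + p 1 0) ∧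
  (ρ + γ) * p 0 1 = p 1 1

/-- `p` is a stationary distribution of the partial flexibility system. -/
def PartialStationary (ρ k γ : ℝ) (p : Fin 2 → Fin 3 → ℝ) : Prop :=
  (∀ m n, 0 ≤ p m n) ∧ (∑ m : Fin 2, ∑ n : Fin 3, p m n) = 1 ∧ PartialBalance ρ k γ p

/-- Throughput of the partial flexibility system. -/
noncomputable def Tps (ρ k : ℝ) (p : Fin 2 → Fin 3 → ℝ) : ℝ :=
  ρ * (1 - p 1 1 - p 1 2) + k*ρ * (1 - p 1 1 - p 1 2 - p 0 1 - p 0 2)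

/-- Throughput of the independent system. -/
noncomputable def Tis (ρ k : ℝ) : ℝ := ρ/(ρ+1) + k*ρ/(k*ρ+1)


/-- Relative values `h` and gain `T`, both scaled by `D`, of the partial flexibility system with
arrival rates `a` and `b`. -/
structure IsRelativeValue (a b g D T : ℝ) (h : Fin 2 → Fin 3 → ℝ) : Prop where
  idle_idle : T = a * (D + h 1 0 - h 0 0) + b * (D + h 0 2 - h 0 0)
  idle_one : T = a * (D + h 1 1 - h 0 1) + g * (h 0 0 - h 0 1)
  idle_two : T = a * (D + h 1 2 - h 0 2) + (h 0 0 - h 0 2)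
  busy_idle : T = a * (D + h 1 1 - h 1 0) + b * (D + h 1 2 - h 1 0) + (h 0 0 - h 1 0)
  busy_one : T = g * (h 1 0 - h 1 1) + (h 0 1 - h 1 1)
  busy_two : T = (h 1 0 - h 1 2) + (h 0 2 - h 1 2)

namespace IsRelativeValue

variable {ρ k γ D T : ℝ} {h : Fin 2 → Fin 3 → ℝ}

/-- The gain of the partial flexibility system is its throughput. -/
lemma mul_Tps (H : IsRelativeValue ρ (k * ρ) γ D T h) {p : Fin 2 → Fin 3 → ℝ}
    (hp : PartialStationary ρ k γ p) : D * Tps ρ k p = T := by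
  obtain ⟨-, hsum, e1, e2, e3, e4, e5, e6⟩ := hp
  simp only [Fin.sum_univ_succ, Fin.sum_univ_zero, Fin.succ_zero_eq_one, Fin.succ_one_eq_two,
    add_zero] at hsum
  unfold Tps
  linear_combination T * hsum - D * (ρ + k * ρ) * hsum + h 0 0 * e1 + h 1 0 * e2 + h 1 2 * e3
    + h 0 2 * e4 + h 1 1 * e5 + h 0 1 * e6 - p 0 0 * H.idle_idle - p 0 1 * H.idle_one
    - p 0 2 * H.idle_two - p 1 0 * H.busy_idle - p 1 1 * H.busy_one - p 1 2 * H.busy_two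

/-- The performance difference formula, where a Type-2 customer at Server 1 is assigned the relative
value of a Type-1 customer there, minus `m`. -/
lemma mul_Tfs (H : IsRelativeValue ρ (k * ρ) γ D T h) {π : Fin 3 → Fin 3 → ℝ}
    (hπ : FullStationary ρ k γ π) (m : ℝ) :
    D * Tfs ρ k π = T
      - k * ρ * ((h 0 1 - h 1 1 - (D - m)) * π 0 1 + (h 0 2 - h 1 2 - (D - m)) * π 0 2)
      - (((1 - γ) * (h 0 0 - h 1 0) - γ * m) * π 2 0
        + ((1 - γ) * (h 0 1 - h 1 1) - γ * m) * π 2 1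
        + ((1 - γ) * (h 0 2 - h 1 2) - γ * m) * π 2 2) := by
  obtain ⟨-, hsum, e1, e2, e3, e4, e5, e6, e7, e8, e9⟩ := hπ
  simp only [Fin.sum_univ_succ, Fin.sum_univ_zero, Fin.succ_zero_eq_one, Fin.succ_one_eq_two,
    add_zero] at hsum
  unfold Tfs
  linear_combination (T - D * (ρ + k * ρ)) * hsum + h 0 0 * e1 + h 1 0 * e2
    + (h 1 0 - m) * e3 + h 0 1 * e4 + h 1 1 * e5 + (h 1 1 - m) * e6 + h 0 2 * e7
    + h 1 2 * e8 + (h 1 2 - m) * e9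
    - π 0 0 * H.idle_idle - π 0 1 * H.idle_one - π 0 2 * H.idle_two
    - (π 1 0 + π 2 0) * H.busy_idle - (π 1 1 + π 2 1) * H.busy_one
    - (π 1 2 + π 2 2) * H.busy_two

end IsRelativeValue

/-- The relative values of the partial flexibility system. When `g < b / (b + 1)`, its gain is below
the throughput of the independent system, and an idle Server 1 is worth more than `a / (a + 1)`. -/
lemma exists_isRelativeValue {a b g : ℝ} (ha : 0 < a) (hb : 0 < b) (hg : 0 < g)
    (hgb : g < b / (b + 1)) :
    ∃ D T h, 0 < D ∧ IsRelativeValue a b g D T h ∧ T < D * (a / (a + 1) + b / (b + 1)) ∧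
      ∀ j, D * (a / (a + 1)) < h 0 j - h 1 j := by
  have he : 0 < b - g * (b + 1) := by
    rwa [sub_pos, ← lt_div_iff₀ (by positivity)]
  let D : ℝ :=
    a^4 + a^3*b*g + a^3*b + 2*a^3*g + 3*a^3 + a^2*b^2*g + a^2*b*g^2 + 7*a^2*b*g
    + a^2*b + a^2*g^2 + 7*a^2*g + 2*a^2 + a*b^2*g^2 + 2*a*b^2*g + 4*a*b*g^2
    + 9*a*b*g + 3*a*g^2 + 7*a*g + b^2*g^2 + b^2*g + 3*b*g^2 + 3*b*g + 2*g^2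
    + 2*g
  let T : ℝ :=
    a^4*g + a^4 + 3*a^3*b*g + a^3*b + a^3*g^2 + 5*a^3*g + 2*a^3 + 2*a^2*b^2*g
    + 3*a^2*b*g^2 + 12*a^2*b*g + 3*a^2*g^2 + 7*a^2*g + 2*a*b^2*g^2 + 3*a*b^2*g
    + 6*a*b*g^2 + 10*a*b*g + 2*a*g^2 + 2*a*g + b^2*g^2 + b^2*g + 2*b*g^2
    + 2*b*g
  let h01 : ℝ :=
    -a^4 + a^3*b*g - 3*a^3*b - 3*a^3 - a^2*b^2 - 8*a^2*b - 2*a^2 - a*b^2*g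
    - 2*a*b^2 - 3*a*b*g - 7*a*b - b^2*g - b^2 - 2*b*g - 2*b
  let h02 : ℝ :=
    -a^4*g - a^3*b*g - a^3*b - a^3*g^2 - 2*a^3*g - a^2*b^2*g - a^2*b*g^2
    - 6*a^2*b*g - a^2*b - a^2*g^2 - a^2*g - a*b^2*g^2 - 2*a*b^2*g - 3*a*b*g^2
    - 7*a*b*g - b^2*g^2 - b^2*g - 2*b*g^2 - 2*b*g
  let h10 : ℝ :=
    -a^4 - 2*a^3*b - a^3*g - 2*a^3 - a^2*b^2*g - 4*a^2*b*g - 3*a^2*b - 2*a^2*g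
    - a*b^2*g^2 - a*b^2*g - a*b*g^2 - 3*a*b*g - 2*a*b
  let h11 : ℝ :=
    -2*a^4 - 4*a^3*b - 2*a^3*g - 5*a^3 - a^2*b^2*g - a^2*b^2 - 7*a^2*b*g - 8*a^2*b
    - 5*a^2*g - 2*a^2 - a*b^2*g^2 - 2*a*b^2*g - 2*a*b^2 - a*b*g^2 - 8*a*b*g
    - 7*a*b - 2*a*g - b^2*g - b^2 - 2*b*g - 2*b
  let h12 : ℝ :=
    -a^4*g - a^4 - 2*a^3*b*g - 2*a^3*b - a^3*g^2 - 4*a^3*g - 2*a^3 - 2*a^2*b^2*g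
    - 2*a^2*b*g^2 - 11*a^2*b*g - 2*a^2*b - 2*a^2*g^2 - 5*a^2*g - 2*a*b^2*g^2
    - 3*a*b^2*g - 5*a*b*g^2 - 10*a*b*g - a*b - a*g^2 - a*g - b^2*g^2 - b^2*g
    - 2*b*g^2 - 2*b*g
  refine ⟨D, T, ![![0, h01, h02], ![h10, h11, h12]], by positivity, ?_, ?_, ?_⟩
  · constructor <;> simp [D, T, h01, h02, h10, h11, h12] <;> ring
  · have : D * (a / (a + 1) + b / (b + 1)) - T = (b - g * (b + 1)) *
        (a^5 + a^4*b + a^4*g + 4*a^4 + a^3*b*g + 2*a^3*b + 3*a^3*g + 5*a^3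
        + a^2*b*g + a^2*b + 2*a^2*g + 2*a^2) / ((a + 1) * (b + 1)) := by
      simp only [D, T]
      field_simp
      ring
    rw [← sub_pos, this]
    positivity
  · intro j
    rw [← sub_pos]
    fin_cases j
    · have : 0 - h10 - D * (a / (a + 1)) =
          (b - g * (b + 1)) * (a * (a + 2) * (a + 1 + g)) := by
        simp only [D, h10]
        field_simp
        ring
      change 0 < 0 - h10 - _
      rw [this]
      positivity
    · have : h01 - h11 - D * (a / (a + 1)) = (b - g * (b + 1)) * (a * g * (a + 2)) := by
        simp only [D, h01, h11]
        field_simp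
        ring
      change 0 < h01 - h11 - _
      rw [this]
      positivity
    · have : h02 - h12 - D * (a / (a + 1)) = (b - g * (b + 1)) * (a * (a + 1 + g)) := by
        simp only [D, h02, h12]
        field_simp
        ring
      change 0 < h02 - h12 - _
      rw [this]
      positivity

/-- In a full flexibility system, Server 1 is idle next to a busy Server 2 with positive
probability. -/
lemma FullStationary.zero_one_pos_or_zero_two_pos {ρ k γ : ℝ} (hρ : 0 < ρ) (hk : 0 < k)
    (hγ : 0 < γ) {π : Fin 3 → Fin 3 → ℝ} (hπ : FullStationary ρ k γ π) :
    0 < π 0 1 ∨ 0 < π 0 2 := by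
  obtain ⟨hnn, hsum, -, -, -, e4, e5, e6, e7, -, -⟩ := hπ
  simp only [Fin.sum_univ_succ, Fin.sum_univ_zero, Fin.succ_zero_eq_one, Fin.succ_one_eq_two,
    add_zero] at hsum
  by_contra! hneg
  have h01 := le_antisymm hneg.1 (hnn 0 1)
  have h02 := le_antisymm hneg.2 (hnn 0 2)
  rw [h01] at e4 e5 e6 hsum
  rw [h02] at e7 hsum
  have := mul_nonneg (mul_pos hk hρ).le (hnn 0 0)
  have := mul_nonneg hγ.le (hnn 2 1)
  have := mul_nonneg hγ.le (hnn 2 2)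
  have h11 : π 1 1 = 0 := by linarith [hnn 1 1]
  have h21 : π 2 1 = 0 := by simpa [h11, hγ.ne'] using e4.symm
  have h12 : π 1 2 = 0 := by linarith [hnn 1 2]
  have h00 : π 0 0 = 0 := by
    have : k * ρ * π 0 0 = 0 := by linarith [hnn 1 2]
    simpa [hρ.ne', hk.ne'] using this
  have h22 : π 2 2 = 0 := by simpa [h00, h12, hγ.ne'] using e7.symm
  have h10 : π 1 0 = 0 := by simpa [h11, hρ.ne'] using e5.symm
  have h20 : π 2 0 = 0 := by simpa [h21, hρ.ne'] using e6.symm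
  linarith


/-- for `γ ∈ (0, kρ/(kρ+1))` one has `T_fs < T_ps < T_is`; the independent
system is optimal on this range. -/
theorem stmt_15 (ρ k γ : ℝ) (hρ : 0 < ρ) (hk : k ∈ Set.Ioo (0:ℝ) 1)
    (hγ : γ ∈ Set.Ioo (0:ℝ) (k*ρ/(k*ρ + 1)))
    (π : Fin 3 → Fin 3 → ℝ) (p : Fin 2 → Fin 3 → ℝ)
    (hπ : FullStationary ρ k γ π) (hp : PartialStationary ρ k γ p) :
    Tfs ρ k π < Tps ρ k p ∧ Tps ρ k p < Tis ρ k := by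
  obtain ⟨hk0, hk1⟩ := hk
  obtain ⟨hγ0, hγ1⟩ := hγ
  have hb : 0 < k * ρ := mul_pos hk0 hρ
  obtain ⟨D, T, h, hD, H, hT, hu⟩ := exists_isRelativeValue hρ hb hγ0 hγ1
  rw [← H.mul_Tps hp] at hT
  refine ⟨lt_of_mul_lt_mul_left ?_ hD.le, lt_of_mul_lt_mul_left hT hD.le⟩
  have hγρ : γ < ρ / (ρ + 1) := by
    refine hγ1.trans ?_
    rw [div_lt_div_iff₀ (by positivity) (by positivity)]
    nlinarith
  have hm : D / (ρ + 1) = D - D * (ρ / (ρ + 1)) := by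
    field_simp
    ring
  have hbusy (j : Fin 3) : 0 ≤ ((1 - γ) * (h 0 j - h 1 j) - γ * (D / (ρ + 1))) * π 2 j := by
    refine mul_nonneg ?_ (hπ.1 2 j)
    have hγ' : γ < 1 := hγρ.trans ((div_lt_one (by positivity)).2 (by linarith))
    rw [hm]
    nlinarith [mul_pos (sub_pos.2 hγ') (sub_pos.2 (hu j)), mul_pos hD (sub_pos.2 hγρ)]
  have hidle (j : Fin 3) : 0 < h 0 j - h 1 j - (D - D / (ρ + 1)) := by
    rw [hm]
    linarith [hu j]
  have hidle' : 0 < (h 0 1 - h 1 1 - (D - D / (ρ + 1))) * π 0 1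
      + (h 0 2 - h 1 2 - (D - D / (ρ + 1))) * π 0 2 := by
    rcases hπ.zero_one_pos_or_zero_two_pos hρ hk0 hγ0 with h0 | h0
    · exact add_pos_of_pos_of_nonneg (mul_pos (hidle 1) h0)
        (mul_nonneg (hidle 2).le (hπ.1 0 2))
    · exact add_pos_of_nonneg_of_pos (mul_nonneg (hidle 1).le (hπ.1 0 1))
        (mul_pos (hidle 2) h0)
  rw [H.mul_Tfs hπ (D / (ρ + 1)), H.mul_Tps hp]
  linarith [mul_pos hb hidle', hbusy 0, hbusy 1, hbusy 2]
end

section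
/- Let ρ > 0 and k ∈ (0,1). Suppose γ^b ∈ (0,1) is such that some stationary distribution π_b of the full flexibility system with parameters (ρ, k, γ^b) satisfies T_fs(π_b) = T_is. Then for every γ with kρ/(kρ+1) < γ < γ^b, and for any stationary distributions π (full flexibility) and p (partial flexibility) with parameters (ρ, k, γ), one has T_fs(π) < T_is < T_ps(p), where T_is = ρ/(ρ+1) + kρ/(kρ+1). -/
/-- The determinant of the balance equations of the full flexibility system, up to a factor. -/
def fullDet (ρ a γ : ℝ) : ℝ :=
    γ * (2 * a + 5 * a ^ 2 + 2 * a ^ 3 + 2 * ρ + 6 * ρ * a + 6 * ρ * a ^ 2 + 5 * ρ ^ 2 +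
    6 * ρ ^ 2 * a + 2 * ρ ^ 3) +
    γ ^ 2 * (4 + 14 * a + 10 * a ^ 2 + 2 * a ^ 3 + 14 * ρ + 28 * ρ * a + 6 * ρ * a ^ 2 +
    10 * ρ ^ 2 + 6 * ρ ^ 2 * a + 2 * ρ ^ 3) +
    γ ^ 3 * (8 + 14 * a + 5 * a ^ 2 + 14 * ρ + 6 * ρ * a + 5 * ρ ^ 2) +
    γ ^ 4 * (4 + 2 * a + 2 * ρ)

/-- The stationary weight of a state with one busy dedicated server; `fullDet` is the weight of
the empty state. -/
def dedicatedWeight (ρ a γ : ℝ) : ℝ :=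
    γ * (2 * ρ * a + 5 * ρ * a ^ 2 + ρ * a ^ 3 + 2 * ρ ^ 2 + 4 * ρ ^ 2 * a + 3 * ρ ^ 2 * a ^ 2 +
    3 * ρ ^ 3 + 3 * ρ ^ 3 * a + ρ ^ 4) +
    γ ^ 2 * (4 * ρ + 14 * ρ * a + 8 * ρ * a ^ 2 + ρ * a ^ 3 + 10 * ρ ^ 2 + 18 * ρ ^ 2 * a +
    3 * ρ ^ 2 * a ^ 2 + 6 * ρ ^ 3 + 3 * ρ ^ 3 * a + ρ ^ 4) +
    γ ^ 3 * (8 * ρ + 14 * ρ * a + 3 * ρ * a ^ 2 + 10 * ρ ^ 2 + 6 * ρ ^ 2 * a + 3 * ρ ^ 3) +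
    γ ^ 4 * (4 * ρ + 2 * ρ * a + 2 * ρ ^ 2)

/-- The stationary weight of a state with one busy non-dedicated server; `fullDet` is the weight
of the empty state. -/
def nondedicatedWeight (ρ a γ : ℝ) : ℝ :=
    (2 * ρ * a ^ 2 + ρ * a ^ 3 + 3 * ρ ^ 2 * a ^ 2 + 2 * ρ ^ 3 + 3 * ρ ^ 3 * a + ρ ^ 4) +
    γ * (2 * ρ * a ^ 2 + ρ * a ^ 3 + 4 * ρ ^ 2 + 10 * ρ ^ 2 * a + 3 * ρ ^ 2 * a ^ 2 + 4 * ρ ^ 3 +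
    3 * ρ ^ 3 * a + ρ ^ 4) +
    γ ^ 2 * (4 * ρ ^ 2 + 2 * ρ ^ 2 * a + 2 * ρ ^ 3)

/-- Minus the constant coefficient of `throughputGap`. -/
def gapCoeff0 (ρ a : ℝ) : ℝ :=
  2 * ρ * a ^ 4 + ρ * a ^ 5 + 2 * ρ ^ 2 * a ^ 3 + 8 * ρ ^ 2 * a ^ 4 + 2 * ρ ^ 2 * a ^ 5 +
  2 * ρ ^ 3 * a ^ 2 + 6 * ρ ^ 3 * a ^ 3 + 6 * ρ ^ 3 * a ^ 4 + 2 * ρ ^ 4 * a + 8 * ρ ^ 4 * a ^ 2 +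
  6 * ρ ^ 4 * a ^ 3 + ρ ^ 5 * a + 2 * ρ ^ 5 * a ^ 2

/-- Minus the linear coefficient of `throughputGap`. -/
def gapCoeff1 (ρ a : ℝ) : ℝ :=
  2 * ρ * a ^ 3 + 3 * ρ * a ^ 4 + 3 * ρ * a ^ 5 + ρ * a ^ 6 + 4 * ρ ^ 2 * a ^ 2 +
  17 * ρ ^ 2 * a ^ 3 + 6 * ρ ^ 2 * a ^ 4 + 3 * ρ ^ 2 * a ^ 5 + 2 * ρ ^ 3 * a +
  17 * ρ ^ 3 * a ^ 2 + 30 * ρ ^ 3 * a ^ 3 + 4 * ρ ^ 3 * a ^ 4 + 3 * ρ ^ 4 * a +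
  6 * ρ ^ 4 * a ^ 2 + 4 * ρ ^ 4 * a ^ 3 + 3 * ρ ^ 5 * a + 3 * ρ ^ 5 * a ^ 2 + ρ ^ 6 * a

/-- The quadratic coefficient of `throughputGap`. -/
def gapCoeff2 (ρ a : ℝ) : ℝ :=
  2 * a ^ 3 + 5 * a ^ 4 + 4 * a ^ 5 + a ^ 6 + 2 * ρ * a ^ 2 + 2 * ρ * a ^ 4 + 2 * ρ * a ^ 5 +
  2 * ρ ^ 2 * a + 14 * ρ ^ 2 * a ^ 2 + 10 * ρ ^ 2 * a ^ 3 + ρ ^ 2 * a ^ 4 + 2 * ρ ^ 2 * a ^ 5 +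
  2 * ρ ^ 3 + 10 * ρ ^ 3 * a ^ 2 + 24 * ρ ^ 3 * a ^ 3 + 6 * ρ ^ 3 * a ^ 4 + 5 * ρ ^ 4 +
  2 * ρ ^ 4 * a + ρ ^ 4 * a ^ 2 + 6 * ρ ^ 4 * a ^ 3 + 4 * ρ ^ 5 + 2 * ρ ^ 5 * a +
  2 * ρ ^ 5 * a ^ 2 + ρ ^ 6

/-- The cubic coefficient of `throughputGap`. -/
def gapCoeff3 (ρ a : ℝ) : ℝ :=
  4 * a ^ 2 + 14 * a ^ 3 + 16 * a ^ 4 + 7 * a ^ 5 + a ^ 6 + 14 * ρ * a ^ 2 + 34 * ρ * a ^ 3 +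
  26 * ρ * a ^ 4 + 7 * ρ * a ^ 5 + ρ * a ^ 6 + 4 * ρ ^ 2 + 14 * ρ ^ 2 * a + 28 * ρ ^ 2 * a ^ 2 +
  39 * ρ ^ 2 * a ^ 3 + 21 * ρ ^ 2 * a ^ 4 + 3 * ρ ^ 2 * a ^ 5 + 14 * ρ ^ 3 + 34 * ρ ^ 3 * a +
  39 * ρ ^ 3 * a ^ 2 + 22 * ρ ^ 3 * a ^ 3 + 4 * ρ ^ 3 * a ^ 4 + 16 * ρ ^ 4 + 26 * ρ ^ 4 * a +
  21 * ρ ^ 4 * a ^ 2 + 4 * ρ ^ 4 * a ^ 3 + 7 * ρ ^ 5 + 7 * ρ ^ 5 * a + 3 * ρ ^ 5 * a ^ 2 +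
  ρ ^ 6 + ρ ^ 6 * a

/-- The quartic coefficient of `throughputGap`. -/
def gapCoeff4 (ρ a : ℝ) : ℝ :=
  8 * a ^ 2 + 18 * a ^ 3 + 13 * a ^ 4 + 3 * a ^ 5 + 18 * ρ * a ^ 2 + 32 * ρ * a ^ 3 +
  17 * ρ * a ^ 4 + 3 * ρ * a ^ 5 + 8 * ρ ^ 2 + 18 * ρ ^ 2 * a + 30 * ρ ^ 2 * a ^ 2 +
  24 * ρ ^ 2 * a ^ 3 + 6 * ρ ^ 2 * a ^ 4 + 18 * ρ ^ 3 + 32 * ρ ^ 3 * a + 24 * ρ ^ 3 * a ^ 2 +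
  6 * ρ ^ 3 * a ^ 3 + 13 * ρ ^ 4 + 17 * ρ ^ 4 * a + 6 * ρ ^ 4 * a ^ 2 + 3 * ρ ^ 5 + 3 * ρ ^ 5 * a

/-- The quintic coefficient of `throughputGap`. -/
def gapCoeff5 (ρ a : ℝ) : ℝ :=
  4 * a ^ 2 + 6 * a ^ 3 + 2 * a ^ 4 + 6 * ρ * a ^ 2 + 8 * ρ * a ^ 3 + 2 * ρ * a ^ 4 + 4 * ρ ^ 2 +
  6 * ρ ^ 2 * a + 4 * ρ ^ 2 * a ^ 2 + 2 * ρ ^ 2 * a ^ 3 + 6 * ρ ^ 3 + 8 * ρ ^ 3 * a +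
  2 * ρ ^ 3 * a ^ 2 + 2 * ρ ^ 4 + 2 * ρ ^ 4 * a

/-- A positive multiple of the throughput difference between the full flexibility system and the
independent system, as a polynomial in `γ`. -/
def throughputGap (ρ a γ : ℝ) : ℝ :=
  γ ^ 2 * (gapCoeff2 ρ a + γ * gapCoeff3 ρ a + γ ^ 2 * gapCoeff4 ρ a + γ ^ 3 * gapCoeff5 ρ a) -
    (gapCoeff0 ρ a + γ * gapCoeff1 ρ a)

/-- Cramer's rule for the first and third unknowns of a sparse `4 × 4` system. -/
lemma sparse_cramer {m11 m12 m13 m21 m22 m24 m31 m33 m34 m42 m43 m44 b₁ b₂ x y z w : ℝ}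
    (h1 : m11 * x + m12 * y + m13 * z = b₁) (h2 : m21 * x + m22 * y + m24 * w = b₂)
    (h3 : m31 * x + m33 * z + m34 * w = 0) (h4 : m42 * y + m43 * z + m44 * w = 0) :
    (m11 * (m22 * m33 * m44 - m22 * m34 * m43 - m24 * m33 * m42) +
        m21 * (m12 * m34 * m43 - m12 * m33 * m44 - m13 * m34 * m42) +
        m31 * (m13 * m24 * m42 - m12 * m24 * m43 - m13 * m22 * m44)) * x =
      (m22 * m33 * m44 - m22 * m34 * m43 - m24 * m33 * m42) * b₁ +
        (m12 * m34 * m43 - m12 * m33 * m44 - m13 * m34 * m42) * b₂ ∧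
    (m11 * (m22 * m33 * m44 - m22 * m34 * m43 - m24 * m33 * m42) +
        m21 * (m12 * m34 * m43 - m12 * m33 * m44 - m13 * m34 * m42) +
        m31 * (m13 * m24 * m42 - m12 * m24 * m43 - m13 * m22 * m44)) * z =
      (m24 * m31 * m42 - m21 * m34 * m42 - m22 * m31 * m44) * b₁ +
        (m11 * m34 * m42 + m12 * m31 * m44) * b₂ := by
  constructor
  · linear_combination (m22 * m33 * m44 - m22 * m34 * m43 - m24 * m33 * m42) * h1 +
      (m12 * m34 * m43 - m12 * m33 * m44 - m13 * m34 * m42) * h2 +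
      (m13 * m24 * m42 - m12 * m24 * m43 - m13 * m22 * m44) * h3 +
      (m12 * m24 * m33 + m13 * m22 * m34) * h4
  · linear_combination (m24 * m31 * m42 - m21 * m34 * m42 - m22 * m31 * m44) * h1 +
      (m11 * m34 * m42 + m12 * m31 * m44) * h2 +
      (m11 * m22 * m44 - m11 * m24 * m42 - m12 * m21 * m44) * h3 +
      (m12 * m21 * m34 - m11 * m22 * m34 - m12 * m24 * m31) * h4

lemma fullDet_mul_eq {ρ a γ e x y z w : ℝ} (hγ : 0 < γ)
    (h1 : (2 * (1 + γ) * (ρ + a + 1) - 2 * γ * ρ - (1 + γ) * a) * x + -((1 + γ) * ρ) * y +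
      -(2 * γ * ρ) * z = 2 * (1 + γ) * ρ * e)
    (h2 : -((1 + γ) * a) * x + (2 * (1 + γ) * (ρ + a + 1) - (1 + γ) * ρ - 2 * γ * a) * y +
      -(2 * γ * a) * w = 2 * (1 + γ) * a * e)
    (h3 : -(2 * ρ) * x + (2 * (1 + γ) * (ρ + a + γ) - 2 * ρ - (1 + γ) * a) * z +
      -((1 + γ) * ρ) * w = 0)
    (h4 : -(2 * a) * y + -((1 + γ) * a) * z +
      (2 * (1 + γ) * (ρ + a + γ) - (1 + γ) * ρ - 2 * a) * w = 0) :
    fullDet ρ a γ * x = dedicatedWeight ρ a γ * e ∧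
      fullDet ρ a γ * z = nondedicatedWeight ρ a γ * e := by
  have hne : 4 * (1 + γ) ^ 2 ≠ 0 := by positivity
  obtain ⟨hx, hz⟩ := sparse_cramer h1 h2 h3 h4
  constructor
  · refine mul_left_cancel₀ hne ?_
    unfold fullDet dedicatedWeight
    linear_combination hx
  · refine mul_left_cancel₀ hne ?_
    unfold fullDet nondedicatedWeight
    linear_combination hz

lemma fullDet_comm (ρ a γ : ℝ) : fullDet a ρ γ = fullDet ρ a γ := by
  unfold fullDet
  ring

lemma fullDet_pos {ρ a γ : ℝ} (hρ : 0 < ρ) (ha : 0 < a) (hγ : 0 < γ) : 0 < fullDet ρ a γ := by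
  unfold fullDet
  positivity

/-- The sign of the throughput difference is the sign of `throughputGap`. -/
lemma exists_pos_mul_throughputGap {ρ k γ : ℝ} (hρ : 0 < ρ) (hk : 0 < k) (hγ : 0 < γ)
    {π : Fin 3 → Fin 3 → ℝ} (hπ : FullStationary ρ k γ π) :
    ∃ s : ℝ, 0 < s ∧ Tfs ρ k π - Tis ρ k = s * throughputGap ρ (k * ρ) γ := by
  obtain ⟨hnn, hsum, -, h10, h20, h01, h11, h21, h02, h12, h22⟩ := hπ
  simp only [Fin.sum_univ_three] at hsum
  have ha : 0 < k * ρ := mul_pos hk hρ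
  have hT : Tfs ρ k π = (ρ + k * ρ) * (1 - π 1 1 - π 1 2 - π 2 1 - π 2 2) := by
    unfold Tfs
    ring
  rw [hT, Tis]
  clear hT
  generalize k * ρ = a at *
  have r1 : (2 * (1 + γ) * (ρ + a + 1) - 2 * γ * ρ - (1 + γ) * a) * π 1 0 +
      -((1 + γ) * ρ) * π 0 2 + -(2 * γ * ρ) * π 0 1 = 2 * (1 + γ) * ρ * π 0 0 := by
    linear_combination 2 * (1 + γ) * h10 + 2 * γ * h11 + (1 + γ) * h12
  have r2 : -((1 + γ) * a) * π 1 0 +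
      (2 * (1 + γ) * (ρ + a + 1) - (1 + γ) * ρ - 2 * γ * a) * π 0 2 + -(2 * γ * a) * π 2 0 =
      2 * (1 + γ) * a * π 0 0 := by
    linear_combination 2 * (1 + γ) * h02 + 2 * γ * h22 + (1 + γ) * h12
  have r3 : -(2 * ρ) * π 1 0 + (2 * (1 + γ) * (ρ + a + γ) - 2 * ρ - (1 + γ) * a) * π 0 1 +
      -((1 + γ) * ρ) * π 2 0 = 0 := by
    linear_combination 2 * (1 + γ) * h01 + 2 * h11 + (1 + γ) * h21
  have r4 : -(2 * a) * π 0 2 + -((1 + γ) * a) * π 0 1 +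
      (2 * (1 + γ) * (ρ + a + γ) - (1 + γ) * ρ - 2 * a) * π 2 0 = 0 := by
    linear_combination 2 * (1 + γ) * h20 + 2 * h22 + (1 + γ) * h21
  obtain ⟨hx, hz⟩ := fullDet_mul_eq hγ r1 r2 r3 r4
  obtain ⟨hy, hw⟩ := fullDet_mul_eq (ρ := a) (a := ρ) (e := π 0 0) (x := π 0 2) (y := π 1 0)
    (z := π 2 0) (w := π 0 1) hγ (by linear_combination r2) (by linear_combination r1)
    (by linear_combination r4) (by linear_combination r3)
  rw [fullDet_comm] at hy hw
  have hD := fullDet_pos hρ ha hγ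
  have he : 0 < π 0 0 := by
    refine (hnn 0 0).lt_of_ne fun he => ?_
    have hcancel {t c : ℝ} (h : fullDet ρ a γ * t = c * π 0 0) : t = 0 := by
      rw [← he, mul_zero] at h
      exact (mul_eq_zero.mp h).resolve_left hD.ne'
    have hx0 := hcancel hx
    have hy0 := hcancel hy
    have hz0 := hcancel hz
    have hw0 := hcancel hw
    have h11' : π 1 1 = 0 := by
      refine (mul_eq_zero.mp (?_ : (1 + γ) * π 1 1 = 0)).resolve_left (by positivity)
      rw [h11, hx0, hz0]
      ring
    have h22' : π 2 2 = 0 := by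
      refine (mul_eq_zero.mp (?_ : (γ + 1) * π 2 2 = 0)).resolve_left (by positivity)
      rw [h22, hy0, hw0]
      ring
    have h21' : π 2 1 = 0 := by
      refine (mul_eq_zero.mp (?_ : 2 * γ * π 2 1 = 0)).resolve_left (by positivity)
      rw [h21, hz0, hw0]
      ring
    have h12' : π 1 2 = 0 := by
      rw [hx0, hy0] at h12
      linarith
    rw [hx0, hy0, hz0, hw0, h11', h22', h21', h12', ← he] at hsum
    norm_num at hsum
  have key : γ * fullDet ρ a γ * (((ρ + a) * (ρ + 1) * (a + 1)) *
      (1 - π 1 1 - π 1 2 - π 2 1 - π 2 2) - (ρ * (a + 1) + a * (ρ + 1))) =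
      π 0 0 * throughputGap ρ a γ := by
    have hscale : 2 * (1 + γ) ≠ 0 := by positivity
    have hred : 2 * (1 + γ) * γ * (((ρ + a) * (ρ + 1) * (a + 1)) *
        (1 - π 1 1 - π 1 2 - π 2 1 - π 2 2) - (ρ * (a + 1) + a * (ρ + 1))) =
        ((ρ + a) * (ρ + 1) * (a + 1) - (ρ * (a + 1) + a * (ρ + 1))) * (2 * (1 + γ) * γ) *
          (π 0 0 + π 1 0 + π 0 2 + π 0 1 + π 2 0) -
        (ρ * (a + 1) + a * (ρ + 1)) * (2 * γ * (ρ * (π 1 0 + π 0 1) + a * (π 2 0 + π 0 2)) +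
          (1 + γ) * (ρ * π 2 0 + a * π 0 1) + γ * (1 + γ) * (ρ * π 0 2 + a * π 1 0)) := by
      linear_combination (-(2 * (1 + γ) * γ) * ((ρ + a) * (ρ + 1) * (a + 1) -
          (ρ * (a + 1) + a * (ρ + 1)))) * hsum - (ρ * (a + 1) + a * (ρ + 1)) *
        (2 * γ * h11 + 2 * γ * h22 + (1 + γ) * h21 + γ * (1 + γ) * h12)
    refine mul_left_cancel₀ hscale ?_
    generalize hA : (ρ + a) * (ρ + 1) * (a + 1) = A at hred ⊢
    generalize hB : ρ * (a + 1) + a * (ρ + 1) = B at hred ⊢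
    have hweights : 2 * (1 + γ) * γ * fullDet ρ a γ *
        (A * (1 - π 1 1 - π 1 2 - π 2 1 - π 2 2) - B) =
        π 0 0 * ((A - B) * (2 * (1 + γ) * γ) * (fullDet ρ a γ + dedicatedWeight ρ a γ +
          dedicatedWeight a ρ γ + nondedicatedWeight ρ a γ + nondedicatedWeight a ρ γ) -
        B * (2 * γ * (ρ * (dedicatedWeight ρ a γ + nondedicatedWeight ρ a γ) +
            a * (nondedicatedWeight a ρ γ + dedicatedWeight a ρ γ)) +
          (1 + γ) * (ρ * nondedicatedWeight a ρ γ + a * nondedicatedWeight ρ a γ) +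
          γ * (1 + γ) * (ρ * dedicatedWeight a ρ γ + a * dedicatedWeight ρ a γ))) := by
      linear_combination fullDet ρ a γ * hred +
        ((A - B) * (2 * (1 + γ) * γ) - B * (2 * γ * ρ + γ * (1 + γ) * a)) * hx +
        ((A - B) * (2 * (1 + γ) * γ) - B * (2 * γ * a + γ * (1 + γ) * ρ)) * hy +
        ((A - B) * (2 * (1 + γ) * γ) - B * (2 * γ * ρ + (1 + γ) * a)) * hz +
        ((A - B) * (2 * (1 + γ) * γ) - B * (2 * γ * a + (1 + γ) * ρ)) * hw
    rw [← mul_assoc, ← mul_assoc, hweights]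
    subst hA hB
    unfold throughputGap gapCoeff0 gapCoeff1 gapCoeff2 gapCoeff3 gapCoeff4 gapCoeff5
      fullDet dedicatedWeight nondedicatedWeight
    ring
  refine ⟨π 0 0 / (γ * fullDet ρ a γ * ((ρ + 1) * (a + 1))), by positivity, ?_⟩
  field_simp
  linear_combination key

lemma gapCoeff_pos {ρ a : ℝ} (hρ : 0 < ρ) (ha : 0 < a) :
    0 < gapCoeff0 ρ a ∧ 0 < gapCoeff1 ρ a ∧ 0 < gapCoeff2 ρ a ∧ 0 < gapCoeff3 ρ a ∧
      0 < gapCoeff4 ρ a ∧ 0 < gapCoeff5 ρ a := by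
  unfold gapCoeff0 gapCoeff1 gapCoeff2 gapCoeff3 gapCoeff4 gapCoeff5
  refine ⟨?_, ?_, ?_, ?_, ?_, ?_⟩ <;> positivity

/-- As a polynomial in `γ`, `throughputGap` changes sign only once, from negative to positive. -/
lemma throughputGap_neg_of_lt {ρ a γ γ' : ℝ} (hρ : 0 < ρ) (ha : 0 < a) (hγ : 0 < γ)
    (hlt : γ < γ') (h : throughputGap ρ a γ' = 0) : throughputGap ρ a γ < 0 := by
  obtain ⟨h0, h1, h2, h3, h4, h5⟩ := gapCoeff_pos hρ ha
  unfold throughputGap at *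
  generalize gapCoeff0 ρ a = c0 at *
  generalize gapCoeff1 ρ a = c1 at *
  generalize gapCoeff2 ρ a = c2 at *
  generalize gapCoeff3 ρ a = c3 at *
  generalize gapCoeff4 ρ a = c4 at *
  generalize gapCoeff5 ρ a = c5 at *
  have hγ' : 0 < γ' := hγ.trans hlt
  have hpos : γ ^ 2 * (c2 + γ * c3 + γ ^ 2 * c4 + γ ^ 3 * c5) <
      γ ^ 2 * (c2 + γ' * c3 + γ' ^ 2 * c4 + γ' ^ 3 * c5) := by gcongr
  have hneg : γ ^ 2 * (c0 + γ' * c1) < γ' ^ 2 * (c0 + γ * c1) := by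
    have : 0 < (γ' - γ) * ((γ' + γ) * c0 + γ * γ' * c1) :=
      mul_pos (sub_pos.mpr hlt) (by positivity)
    linarith
  have hroot : γ' ^ 2 * (c2 + γ' * c3 + γ' ^ 2 * c4 + γ' ^ 3 * c5) = c0 + γ' * c1 := by
    linarith
  rw [← hroot] at hneg
  have hγ'2 : 0 < γ' ^ 2 := by positivity
  have : γ ^ 2 * (c2 + γ' * c3 + γ' ^ 2 * c4 + γ' ^ 3 * c5) < c0 + γ * c1 :=
    lt_of_mul_lt_mul_left (by linarith) hγ'2.le
  linarith

/-- Partial flexibility beats independence as soon as `γ > kρ / (kρ + 1)`. -/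
lemma Tis_lt_Tps {ρ k γ : ℝ} (hρ : 0 < ρ) (hk : 0 < k) (hγ : k * ρ / (k * ρ + 1) < γ)
    {p : Fin 2 → Fin 3 → ℝ} (hp : PartialStationary ρ k γ p) : Tis ρ k < Tps ρ k p := by
  obtain ⟨hnn, hsum, h00, h10, h12, h02, h11, h01⟩ := hp
  simp only [Fin.sum_univ_two, Fin.sum_univ_three] at hsum
  have ha : 0 < k * ρ := mul_pos hk hρ
  unfold Tis Tps
  generalize k * ρ = a at *
  rw [div_lt_iff₀ (by positivity)] at hγ
  have hγ0 : 0 < γ := by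
    by_contra! hle
    nlinarith
  have hx : ρ * p 1 0 = γ * (ρ + γ + 1) * p 0 1 := by
    linear_combination -(1 + γ) * h01 - h11
  have hy : (ρ + 2) * p 0 2 = 2 * a * p 0 0 + a * p 1 0 := by
    linear_combination 2 * h02 + h12
  have he : ρ ^ 2 * (ρ + a + 2) * p 0 0 =
      γ * ((2 + a + 5 * ρ + 2 * ρ ^ 2 + a * ρ) + γ * (2 + a + ρ)) * p 0 1 := by
    linear_combination -ρ * (ρ + 2) * h10 - ρ * (ρ + 2) / 2 * h12 - ρ ^ 2 / 2 * hy +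
      γ * ρ * (ρ + 2) * h01 + ((ρ + 2) * (ρ + 1) + a) * hx
  have hx' : p 1 0 = γ * (ρ + γ + 1) * p 0 1 / ρ := by
    rw [eq_div_iff hρ.ne']
    linarith
  have he' : p 0 0 = γ * ((2 + a + 5 * ρ + 2 * ρ ^ 2 + a * ρ) + γ * (2 + a + ρ)) * p 0 1 /
      (ρ ^ 2 * (ρ + a + 2)) := by
    rw [eq_div_iff (by positivity)]
    linarith
  have hy' : p 0 2 = (2 * a * p 0 0 + a * p 1 0) / (ρ + 2) := by
    rw [eq_div_iff (by positivity)]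
    linarith
  have h12' : p 1 2 = (ρ * p 0 2 + a * p 1 0) / 2 := by linarith
  have hz : 0 < p 0 1 := by
    refine (hnn 0 1).lt_of_ne fun hz => ?_
    simp only [← hz, mul_zero, zero_div] at hx' he' h01
    simp only [hx', he', mul_zero, add_zero, zero_div] at hy'
    simp only [hx', hy', mul_zero, add_zero, zero_div] at h12'
    rw [hx', he', hy', h12', ← h01, ← hz] at hsum
    norm_num at hsum
  have hgap : (ρ + a + 2) * ((ρ + 1) * (a + 1) * (ρ * (1 - p 1 1 - p 1 2) +
      a * (1 - p 1 1 - p 1 2 - p 0 1 - p 0 2)) - (ρ * (a + 1) + a * (ρ + 1))) =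
      p 0 1 * (γ * (a + 1) - a) * ((ρ + 1) *
        (ρ ^ 2 + (3 + γ + a) * ρ + (1 + γ) * (2 + a))) := by
    have hhom : (ρ + 1) * (a + 1) * (ρ * (1 - p 1 1 - p 1 2) +
        a * (1 - p 1 1 - p 1 2 - p 0 1 - p 0 2)) - (ρ * (a + 1) + a * (ρ + 1)) =
        (ρ + 1) * (a + 1) * (ρ * (p 0 0 + p 1 0 + p 0 1 + p 0 2) + a * (p 0 0 + p 1 0)) -
        (ρ * (a + 1) + a * (ρ + 1)) *
          (p 0 0 + p 1 0 + p 0 1 + p 0 2 + p 1 1 + p 1 2) := by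
      linear_combination ((ρ * (a + 1) + a * (ρ + 1)) - (ρ + 1) * (a + 1) * (ρ + a)) * hsum
    rw [hhom, ← h01, h12', hy', he', hx']
    field_simp
    ring
  have hpos : 0 < p 0 1 * (γ * (a + 1) - a) * ((ρ + 1) *
      (ρ ^ 2 + (3 + γ + a) * ρ + (1 + γ) * (2 + a))) :=
    mul_pos (mul_pos hz (sub_pos.mpr hγ)) (by positivity)
  rw [← hgap] at hpos
  have hlt := pos_of_mul_pos_right hpos (by positivity)
  rw [div_add_div _ _ (by positivity) (by positivity), div_lt_iff₀ (by positivity)]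
  linarith

/-- for `γ ∈ (kρ/(kρ+1), γ^b)` one has `T_fs < T_is < T_ps`. -/
theorem stmt_16 (ρ k : ℝ) (hρ : 0 < ρ) (hk : k ∈ Set.Ioo (0:ℝ) 1)
    (γb : ℝ) (hγb : γb ∈ Set.Ioo (0:ℝ) 1)
    (hb : ∃ πb : Fin 3 → Fin 3 → ℝ, FullStationary ρ k γb πb ∧ Tfs ρ k πb = Tis ρ k)
    (γ : ℝ) (hγ : k*ρ/(k*ρ + 1) < γ) (hγ' : γ < γb)
    (π : Fin 3 → Fin 3 → ℝ) (p : Fin 2 → Fin 3 → ℝ)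
    (hπ : FullStationary ρ k γ π) (hp : PartialStationary ρ k γ p) :
    Tfs ρ k π < Tis ρ k ∧ Tis ρ k < Tps ρ k p := by
  have hk0 : 0 < k := hk.1
  have hγ0 : 0 < γ := lt_of_le_of_lt (by positivity) hγ
  refine ⟨?_, Tis_lt_Tps hρ hk0 hγ hp⟩
  obtain ⟨πb, hπb, hTb⟩ := hb
  obtain ⟨s, hs, hgap⟩ := exists_pos_mul_throughputGap hρ hk0 hγb.1 hπb
  obtain ⟨t, ht, hgap'⟩ := exists_pos_mul_throughputGap hρ hk0 hγ0 hπ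
  rw [hTb, sub_self, eq_comm] at hgap
  have hneg := throughputGap_neg_of_lt hρ (mul_pos hk0 hρ) hγ0 hγ'
    ((mul_eq_zero.mp hgap).resolve_left hs.ne')
  have := mul_neg_of_pos_of_neg ht hneg
  linarith
end

section
/- Let ρ > 0 and k ∈ (0,1). Suppose γ^b ∈ (0,1) is such that some stationary distribution π_b of the full flexibility system with parameters (ρ, k, γ^b) satisfies T_fs(π_b) = T_is, and γ^r ∈ (0,1) is such that some stationary distributions π_r (full flexibility) and p_r (partial flexibility) with parameters (ρ, k, γ^r) satisfy T_fs(π_r) = T_ps(p_r). Then for every γ with γ^b < γ < γ^r, and for any stationary distributions π (full flexibility) and p (partial flexibility) with parameters (ρ, k, γ), one has T_is < T_fs(π) < T_ps(p), where T_is = ρ/(ρ+1) + kρ/(kρ+1). -/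
/-- A real polynomial whose coefficients change sign at most once changes sign at most once on the
positive half-line. -/
theorem mul_sq_lt_mul_sq_of_one_sign_change {c0 c1 c2 c3 c4 c5 c6 c7 s t : ℝ}
    (hs : 0 < s) (hst : s < t) (h0 : 0 < c0) (h1 : 0 ≤ c1) (h3 : 0 ≤ c3) (h4 : 0 ≤ c4)
    (h5 : 0 ≤ c5) (h6 : 0 ≤ c6) (h7 : 0 ≤ c7) {F : ℝ → ℝ}
    (hF : ∀ x, F x = -c0 - c1*x + c2*x^2 + c3*x^3 + c4*x^4 + c5*x^5 + c6*x^6 + c7*x^7) :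
    F s * t^2 < F t * s^2 := by
  have ht : 0 < t := hs.trans hst
  have hpow : ∀ n : ℕ, 0 ≤ t^n - s^n := fun n => sub_nonneg.2 (by gcongr)
  have hsq : 0 < t^2 - s^2 := sub_pos.2 (by gcongr)
  have key : F t * s^2 - F s * t^2 = c0*(t^2 - s^2) + c1*(s*t)*(t^1 - s^1)
      + (s*t)^2*(c3*(t^1 - s^1) + c4*(t^2 - s^2) + c5*(t^3 - s^3) + c6*(t^4 - s^4)
        + c7*(t^5 - s^5)) := by
    rw [hF, hF]
    ring
  have := hpow 1
  have := hpow 3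
  have := hpow 4
  have := hpow 5
  have : 0 < F t * s^2 - F s * t^2 := by
    rw [key]
    positivity
  linarith

/-- The normalising polynomial of the full flexibility system. -/
def fullNorm (ρ k γ : ℝ) : ℝ :=
  ρ^5*k^4 + 3*ρ^5*k^3 + 3*ρ^5*k^2 + ρ^5*k + 2*ρ^4*k^3 + 2*ρ^4*k + (ρ^5*k^5 + 4*ρ^5*k^4 +
  7*ρ^5*k^3 + 7*ρ^5*k^2 + 4*ρ^5*k + ρ^5 + 3*ρ^4*k^4 + 7*ρ^4*k^3 + 20*ρ^4*k^2 + 7*ρ^4*k + 3*ρ^4 +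
  2*ρ^3*k^3 + 4*ρ^3*k^2 + 4*ρ^3*k + 2*ρ^3)*γ + (ρ^5*k^5 + 4*ρ^5*k^4 + 7*ρ^5*k^3 + 7*ρ^5*k^2 +
  4*ρ^5*k + ρ^5 + 7*ρ^4*k^4 + 27*ρ^4*k^3 + 28*ρ^4*k^2 + 27*ρ^4*k + 7*ρ^4 + 15*ρ^3*k^3 +
  33*ρ^3*k^2 + 33*ρ^3*k + 15*ρ^3 + 11*ρ^2*k^2 + 10*ρ^2*k + 11*ρ^2 + 2*ρ*k + 2*ρ)*γ^2 + (ρ^5*k^4 +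
  3*ρ^5*k^3 + 3*ρ^5*k^2 + ρ^5*k + 4*ρ^4*k^4 + 17*ρ^4*k^3 + 30*ρ^4*k^2 + 17*ρ^4*k + 4*ρ^4 +
  18*ρ^3*k^3 + 58*ρ^3*k^2 + 58*ρ^3*k + 18*ρ^3 + 28*ρ^2*k^2 + 60*ρ^2*k + 28*ρ^2 + 18*ρ*k + 18*ρ +
  4)*γ^3 + (3*ρ^4*k^3 + 6*ρ^4*k^2 + 3*ρ^4*k + 5*ρ^3*k^3 + 23*ρ^3*k^2 + 23*ρ^3*k + 5*ρ^3 +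
  19*ρ^2*k^2 + 42*ρ^2*k + 19*ρ^2 + 22*ρ*k + 22*ρ + 8)*γ^4 + (2*ρ^3*k^2 + 2*ρ^3*k + 2*ρ^2*k^2 +
  8*ρ^2*k + 2*ρ^2 + 6*ρ*k + 6*ρ + 4)*γ^5

/-- The unnormalised probability that some server is idle in the full flexibility system. -/
def fullIdle (ρ k γ : ℝ) : ℝ :=
  (ρ^4*k^4 + 4*ρ^4*k^3 + 6*ρ^4*k^2 + 4*ρ^4*k + ρ^4 + 2*ρ^3*k^3 + 2*ρ^3*k^2 + 2*ρ^3*k + 2*ρ^3)*γ +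
  (2*ρ^4*k^4 + 8*ρ^4*k^3 + 12*ρ^4*k^2 + 8*ρ^4*k + 2*ρ^4 + 9*ρ^3*k^3 + 27*ρ^3*k^2 + 27*ρ^3*k +
  9*ρ^3 + 11*ρ^2*k^2 + 10*ρ^2*k + 11*ρ^2 + 2*ρ*k + 2*ρ)*γ^2 + (ρ^4*k^4 + 4*ρ^4*k^3 + 6*ρ^4*k^2 +
  4*ρ^4*k + ρ^4 + 10*ρ^3*k^3 + 34*ρ^3*k^2 + 34*ρ^3*k + 10*ρ^3 + 24*ρ^2*k^2 + 56*ρ^2*k + 24*ρ^2 +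
  18*ρ*k + 18*ρ + 4)*γ^3 + (3*ρ^3*k^3 + 9*ρ^3*k^2 + 9*ρ^3*k + 3*ρ^3 + 15*ρ^2*k^2 + 34*ρ^2*k +
  15*ρ^2 + 22*ρ*k + 22*ρ + 8)*γ^4 + (2*ρ^2*k^2 + 4*ρ^2*k + 2*ρ^2 + 6*ρ*k + 6*ρ + 4)*γ^5

/-- The normalising polynomial of the partial flexibility system. -/
def partialNorm (ρ k γ : ℝ) : ℝ :=
  ρ^4*k + ρ^4 + ρ^3*k + 3*ρ^3 + 2*ρ^2 + (ρ^4*k^2 + ρ^4*k + 2*ρ^3*k^2 + 7*ρ^3*k + 2*ρ^3 + ρ^2*k^2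
  + 9*ρ^2*k + 7*ρ^2 + 3*ρ*k + 7*ρ + 2)*γ + (ρ^3*k^2 + ρ^3*k + ρ^2*k^2 + 4*ρ^2*k + ρ^2 + 3*ρ*k +
  3*ρ + 2)*γ^2

/-- The unnormalised throughput of the partial flexibility system. -/
def partialThru (ρ k γ : ℝ) : ℝ :=
  ρ^4*k + ρ^4 + 2*ρ^3 + (2*ρ^4*k^2 + 3*ρ^4*k + ρ^4 + 3*ρ^3*k^2 + 12*ρ^3*k + 5*ρ^3 + ρ^2*k^2 +
  10*ρ^2*k + 7*ρ^2 + 2*ρ*k + 2*ρ)*γ + (2*ρ^3*k^2 + 3*ρ^3*k + ρ^3 + ρ^2*k^2 + 6*ρ^2*k + 3*ρ^2 +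
  2*ρ*k + 2*ρ)*γ^2

theorem fullNorm_pos {ρ k γ : ℝ} (hρ : 0 < ρ) (hk : 0 < k) (hγ : 0 < γ) :
    0 < fullNorm ρ k γ := by
  rw [fullNorm]
  positivity

theorem partialNorm_pos {ρ k γ : ℝ} (hρ : 0 < ρ) (hk : 0 < k) (hγ : 0 < γ) :
    0 < partialNorm ρ k γ := by
  rw [partialNorm]
  positivity

/-- The numerator of the throughput gap between the full flexibility and the independent system. -/
def independentGap (ρ k γ : ℝ) : ℝ :=
  (k + 1)*ρ*fullIdle ρ k γ*((ρ + 1)*(k*ρ + 1)) - fullNorm ρ k γ*(ρ*(k*ρ + 1) + k*ρ*(ρ + 1))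

/-- The numerator of the throughput gap between the full and the partial flexibility system. -/
def partialGap (ρ k γ : ℝ) : ℝ :=
  (k + 1)*ρ*fullIdle ρ k γ*partialNorm ρ k γ - partialThru ρ k γ*fullNorm ρ k γ

theorem FullStationary.throughput_mul_norm {ρ k γ : ℝ} (hρ : 0 < ρ) (hk : 0 < k)
    (hγ : 0 < γ) {π : Fin 3 → Fin 3 → ℝ} (h : FullStationary ρ k γ π) :
    Tfs ρ k π * fullNorm ρ k γ = (k + 1) * ρ * fullIdle ρ k γ := by
  obtain ⟨-, hsum, -, h2, h3, h4, h5, h6, h7, h8, h9⟩ := h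
  simp only [Fin.sum_univ_three] at hsum
  have e1 : (ρ*k*γ + ρ*k + 2*ρ + 2*γ + 2) * π 1 0 + (-ρ*γ - ρ) * π 0 2 + (-2*ρ*γ) * π 0 1 =
    (2*ρ*γ + 2*ρ) * π 0 0 := by
    linear_combination 2*(1+γ)*h2 + 2*γ*h5 + (1+γ)*h8
  have e2 : (-ρ*k*γ - ρ*k) * π 1 0 + (2*ρ*k + ρ*γ + ρ + 2*γ + 2) * π 0 2 + (-2*ρ*k*γ) * π 2 0 =
    (2*ρ*k*γ + 2*ρ*k) * π 0 0 := by
    linear_combination 2*(1+γ)*h7 + (1+γ)*h8 + 2*γ*h9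
  have e3 : (-2*ρ) * π 1 0 + (ρ*k*γ + ρ*k + 2*ρ*γ + 2*γ^2 + 2*γ) * π 0 1 + (-ρ*γ - ρ) * π 2 0 =
    0 := by
    linear_combination 2*(1+γ)*h4 + 2*h5 + (1+γ)*h6
  have e4 : (-2*ρ*k) * π 0 2 + (-ρ*k*γ - ρ*k) * π 0 1 + (2*ρ*k*γ + ρ*γ + ρ + 2*γ^2 + 2*γ) * π 2
    0 = 0 := by
    linear_combination 2*(1+γ)*h3 + (1+γ)*h6 + 2*h9
  obtain ⟨w, hw⟩ : ∃ w : ℝ, w =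
      (2*ρ^3*k^3 + 6*ρ^3*k^2 + 6*ρ^3*k + 2*ρ^3 + 5*ρ^2*k^2 + 6*ρ^2*k + 5*ρ^2 + 2*ρ*k + 2*ρ)*γ +
      (2*ρ^3*k^3 + 6*ρ^3*k^2 + 6*ρ^3*k + 2*ρ^3 + 10*ρ^2*k^2 + 28*ρ^2*k + 10*ρ^2 + 14*ρ*k + 14*ρ +
      4)*γ^2 + (5*ρ^2*k^2 + 6*ρ^2*k + 5*ρ^2 + 14*ρ*k + 14*ρ + 8)*γ^3 + (2*ρ*k + 2*ρ +
      4)*γ^4 := ⟨_, rfl⟩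
  have hw_pos : 0 < w := by
    rw [hw]
    positivity
  have hx : w * π 1 0 =
      ((ρ^4*k^3 + 3*ρ^4*k^2 + 3*ρ^4*k + ρ^4 + 5*ρ^3*k^2 + 4*ρ^3*k + 3*ρ^3 + 2*ρ^2*k + 2*ρ^2)*γ +
      (ρ^4*k^3 + 3*ρ^4*k^2 + 3*ρ^4*k + ρ^4 + 8*ρ^3*k^2 + 18*ρ^3*k + 6*ρ^3 + 14*ρ^2*k + 10*ρ^2 +
      4*ρ)*γ^2 + (3*ρ^3*k^2 + 6*ρ^3*k + 3*ρ^3 + 14*ρ^2*k + 10*ρ^2 + 8*ρ)*γ^3 + (2*ρ^2*k + 2*ρ^2 +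
      4*ρ)*γ^4) * π 0 0 := by
    have hc : 4*(1+γ)^2 ≠ 0 := by positivity
    refine mul_left_cancel₀ hc ?_
    rw [hw]
    linear_combination
      ((2*ρ^3*k^2 + 4*ρ^3*k + 2*ρ^3 + 8*ρ^2*k^2 + 6*ρ^2*k + 6*ρ^2 + 4*ρ*k + 4*ρ)*γ + (4*ρ^3*k^2 +
      8*ρ^3*k + 4*ρ^3 + 16*ρ^2*k^2 + 34*ρ^2*k + 18*ρ^2 + 28*ρ*k + 24*ρ + 8)*γ^2 + (2*ρ^3*k^2 +
      4*ρ^3*k + 2*ρ^3 + 8*ρ^2*k^2 + 34*ρ^2*k + 18*ρ^2 + 44*ρ*k + 40*ρ + 24)*γ^3 + (6*ρ^2*k +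
      6*ρ^2 + 20*ρ*k + 24*ρ + 24)*γ^4 + (4*ρ + 8)*γ^5)*e1 + ((2*ρ^3*k^2 + 4*ρ^3*k + 2*ρ^3 +
      2*ρ^2*k + 2*ρ^2)*γ + (4*ρ^3*k^2 + 8*ρ^3*k + 4*ρ^3 + 10*ρ^2*k + 10*ρ^2 + 4*ρ)*γ^2 +
      (2*ρ^3*k^2 + 4*ρ^3*k + 2*ρ^3 + 14*ρ^2*k + 14*ρ^2 + 12*ρ)*γ^3 + (6*ρ^2*k + 6*ρ^2 + 12*ρ)*γ^4
      + 4*ρ*γ^5)*e2 + ((2*ρ^3*k^2 + 4*ρ^3*k + 2*ρ^3 + 4*ρ^2)*γ + (4*ρ^3*k^2 + 8*ρ^3*k + 4*ρ^3 +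
      16*ρ^2*k + 12*ρ^2 + 8*ρ)*γ^2 + (2*ρ^3*k^2 + 4*ρ^3*k + 2*ρ^3 + 16*ρ^2*k + 12*ρ^2 + 16*ρ)*γ^3
      + (4*ρ^2 + 8*ρ)*γ^4)*e3 + ((2*ρ^3*k^2 + 4*ρ^3*k + 2*ρ^3 + 4*ρ^2)*γ + (4*ρ^3*k^2 + 8*ρ^3*k +
      4*ρ^3 + 4*ρ^2*k + 8*ρ^2)*γ^2 + (2*ρ^3*k^2 + 4*ρ^3*k + 2*ρ^3 + 8*ρ^2*k + 4*ρ^2)*γ^3 +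
      4*ρ^2*k*γ^4)*e4
  have hy : w * π 0 2 =
      ((ρ^4*k^4 + 3*ρ^4*k^3 + 3*ρ^4*k^2 + ρ^4*k + 3*ρ^3*k^3 + 4*ρ^3*k^2 + 5*ρ^3*k + 2*ρ^2*k^2 +
      2*ρ^2*k)*γ + (ρ^4*k^4 + 3*ρ^4*k^3 + 3*ρ^4*k^2 + ρ^4*k + 6*ρ^3*k^3 + 18*ρ^3*k^2 + 8*ρ^3*k +
      10*ρ^2*k^2 + 14*ρ^2*k + 4*ρ*k)*γ^2 + (3*ρ^3*k^3 + 6*ρ^3*k^2 + 3*ρ^3*k + 10*ρ^2*k^2 +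
      14*ρ^2*k + 8*ρ*k)*γ^3 + (2*ρ^2*k^2 + 2*ρ^2*k + 4*ρ*k)*γ^4) * π 0 0 := by
    have hc : 4*(1+γ)^2 ≠ 0 := by positivity
    refine mul_left_cancel₀ hc ?_
    rw [hw]
    linear_combination
      ((2*ρ^3*k^3 + 4*ρ^3*k^2 + 2*ρ^3*k + 2*ρ^2*k^2 + 2*ρ^2*k)*γ + (4*ρ^3*k^3 + 8*ρ^3*k^2 +
      4*ρ^3*k + 10*ρ^2*k^2 + 10*ρ^2*k + 4*ρ*k)*γ^2 + (2*ρ^3*k^3 + 4*ρ^3*k^2 + 2*ρ^3*k +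
      14*ρ^2*k^2 + 14*ρ^2*k + 12*ρ*k)*γ^3 + (6*ρ^2*k^2 + 6*ρ^2*k + 12*ρ*k)*γ^4 + 4*ρ*k*γ^5)*e1 +
      ((2*ρ^3*k^3 + 4*ρ^3*k^2 + 2*ρ^3*k + 6*ρ^2*k^2 + 6*ρ^2*k + 8*ρ^2 + 4*ρ*k + 4*ρ)*γ +
      (4*ρ^3*k^3 + 8*ρ^3*k^2 + 4*ρ^3*k + 18*ρ^2*k^2 + 34*ρ^2*k + 16*ρ^2 + 24*ρ*k + 28*ρ + 8)*γ^2
      + (2*ρ^3*k^3 + 4*ρ^3*k^2 + 2*ρ^3*k + 18*ρ^2*k^2 + 34*ρ^2*k + 8*ρ^2 + 40*ρ*k + 44*ρ +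
      24)*γ^3 + (6*ρ^2*k^2 + 6*ρ^2*k + 24*ρ*k + 20*ρ + 24)*γ^4 + (4*ρ*k + 8)*γ^5)*e2 +
      ((2*ρ^3*k^3 + 4*ρ^3*k^2 + 2*ρ^3*k + 4*ρ^2*k^2)*γ + (4*ρ^3*k^3 + 8*ρ^3*k^2 + 4*ρ^3*k +
      8*ρ^2*k^2 + 4*ρ^2*k)*γ^2 + (2*ρ^3*k^3 + 4*ρ^3*k^2 + 2*ρ^3*k + 4*ρ^2*k^2 + 8*ρ^2*k)*γ^3 +
      4*ρ^2*k*γ^4)*e3 + ((2*ρ^3*k^3 + 4*ρ^3*k^2 + 2*ρ^3*k + 4*ρ^2*k^2)*γ + (4*ρ^3*k^3 + 8*ρ^3*k^2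
      + 4*ρ^3*k + 12*ρ^2*k^2 + 16*ρ^2*k + 8*ρ*k)*γ^2 + (2*ρ^3*k^3 + 4*ρ^3*k^2 + 2*ρ^3*k +
      12*ρ^2*k^2 + 16*ρ^2*k + 16*ρ*k)*γ^3 + (4*ρ^2*k^2 + 8*ρ*k)*γ^4)*e4
  have hu : w * π 0 1 =
      (ρ^4*k^3 + 3*ρ^4*k^2 + 3*ρ^4*k + ρ^4 + 2*ρ^3*k^2 + 2*ρ^3 + (ρ^4*k^3 + 3*ρ^4*k^2 + 3*ρ^4*k +
      ρ^4 + 2*ρ^3*k^2 + 10*ρ^3*k + 4*ρ^3 + 4*ρ^2)*γ + (2*ρ^3*k + 2*ρ^3 + 4*ρ^2)*γ^2) * π 0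
      0 := by
    have hc : 2*(1+γ) ≠ 0 := by positivity
    refine mul_left_cancel₀ hc ?_
    rw [hw]
    linear_combination
      (ρ^3*k^2 + 2*ρ^3*k + ρ^3 + 2*ρ^2 + (ρ^3*k^2 + 2*ρ^3*k + ρ^3 + 8*ρ^2*k + 4*ρ^2 + 4*ρ)*γ +
      (2*ρ^2 + 4*ρ)*γ^2)*e1 + (ρ^3*k^2 + 2*ρ^3*k + ρ^3 + 2*ρ^2*k + (ρ^3*k^2 + 2*ρ^3*k + ρ^3 +
      2*ρ^2*k + 2*ρ^2)*γ + 2*ρ^2*γ^2)*e2 + (ρ^3*k^2 + 2*ρ^3*k + ρ^3 + 3*ρ^2*k + 3*ρ^2 + 2*ρ +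
      (ρ^3*k^2 + 2*ρ^3*k + ρ^3 + 4*ρ^2*k^2 + 14*ρ^2*k + 6*ρ^2 + 10*ρ*k + 10*ρ + 4)*γ + (4*ρ^2*k^2
      + 3*ρ^2*k + 3*ρ^2 + 12*ρ*k + 10*ρ + 8)*γ^2 + (2*ρ*k + 2*ρ + 4)*γ^3)*e3 + (ρ^3*k^2 + 2*ρ^3*k
      + ρ^3 + 3*ρ^2*k + 3*ρ^2 + 2*ρ + (ρ^3*k^2 + 2*ρ^3*k + ρ^3 + 4*ρ^2*k + 4*ρ^2 + 4*ρ)*γ +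
      (ρ^2*k + ρ^2 + 2*ρ)*γ^2)*e4
  have hv : w * π 2 0 =
      (ρ^4*k^4 + 3*ρ^4*k^3 + 3*ρ^4*k^2 + ρ^4*k + 2*ρ^3*k^3 + 2*ρ^3*k + (ρ^4*k^4 + 3*ρ^4*k^3 +
      3*ρ^4*k^2 + ρ^4*k + 4*ρ^3*k^3 + 10*ρ^3*k^2 + 2*ρ^3*k + 4*ρ^2*k^2)*γ + (2*ρ^3*k^3 +
      2*ρ^3*k^2 + 4*ρ^2*k^2)*γ^2) * π 0 0 := by
    have hc : 2*(1+γ) ≠ 0 := by positivity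
    refine mul_left_cancel₀ hc ?_
    rw [hw]
    linear_combination
      (ρ^3*k^3 + 2*ρ^3*k^2 + ρ^3*k + 2*ρ^2*k + (ρ^3*k^3 + 2*ρ^3*k^2 + ρ^3*k + 2*ρ^2*k^2 +
      2*ρ^2*k)*γ + 2*ρ^2*k^2*γ^2)*e1 + (ρ^3*k^3 + 2*ρ^3*k^2 + ρ^3*k + 2*ρ^2*k^2 + (ρ^3*k^3 +
      2*ρ^3*k^2 + ρ^3*k + 4*ρ^2*k^2 + 8*ρ^2*k + 4*ρ*k)*γ + (2*ρ^2*k^2 + 4*ρ*k)*γ^2)*e2 + (ρ^3*k^3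
      + 2*ρ^3*k^2 + ρ^3*k + 3*ρ^2*k^2 + 3*ρ^2*k + 2*ρ*k + (ρ^3*k^3 + 2*ρ^3*k^2 + ρ^3*k +
      4*ρ^2*k^2 + 4*ρ^2*k + 4*ρ*k)*γ + (ρ^2*k^2 + ρ^2*k + 2*ρ*k)*γ^2)*e3 + (ρ^3*k^3 + 2*ρ^3*k^2 +
      ρ^3*k + 3*ρ^2*k^2 + 3*ρ^2*k + 2*ρ*k + (ρ^3*k^3 + 2*ρ^3*k^2 + ρ^3*k + 6*ρ^2*k^2 + 14*ρ^2*k +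
      4*ρ^2 + 10*ρ*k + 10*ρ + 4)*γ + (3*ρ^2*k^2 + 3*ρ^2*k + 4*ρ^2 + 10*ρ*k + 12*ρ + 8)*γ^2 +
      (2*ρ*k + 2*ρ + 4)*γ^3)*e4
  have hidle : 2*γ*(1+γ)*w * (1 - π 1 1 - π 1 2 - π 2 1 - π 2 2) =
      2*(1+γ) * fullIdle ρ k γ * π 0 0 := by
    rw [fullIdle]
    linear_combination 2*γ*(1+γ)*(hx + hy + hu + hv) + 2*γ*(1+γ)*π 0 0*hw - 2*γ*(1+γ)*w*hsum
  have hnorm : 2*γ*(1+γ)*w = 2*(1+γ) * fullNorm ρ k γ * π 0 0 := by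
    rw [fullNorm]
    linear_combination (norm := skip) hidle + 2*γ*w*(h5 + h9) + (1+γ)*w*h6 + γ*(1+γ)*w*h8
      + (2*γ*ρ + γ*(1+γ)*k*ρ)*hx + (2*γ*k*ρ + γ*(1+γ)*ρ)*hy
      + (2*γ*ρ + (1+γ)*k*ρ)*hu + (2*γ*k*ρ + (1+γ)*ρ)*hv
    rw [fullIdle]
    ring
  refine mul_left_cancel₀ (show 2*γ*(1+γ)*w ≠ 0 by positivity) ?_
  rw [Tfs]
  linear_combination (k + 1)*ρ*(fullNorm ρ k γ * hidle - fullIdle ρ k γ * hnorm)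

theorem PartialStationary.throughput_mul_norm {ρ k γ : ℝ} (hρ : 0 < ρ) (hk : 0 < k) (hγ : 0 < γ)
    {p : Fin 2 → Fin 3 → ℝ} (h : PartialStationary ρ k γ p) :
    Tps ρ k p * partialNorm ρ k γ = partialThru ρ k γ := by
  obtain ⟨-, hsum, -, h2, h3, h4, h5, h6⟩ := h
  simp only [Fin.sum_univ_two, Fin.sum_univ_three] at hsum
  have e1 : (ρ*k*γ + ρ*k + 2*ρ + 2*γ + 2) * p 1 0 + (-ρ*γ - ρ) * p 0 2 + (-2*ρ*γ) * p 0 1 =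
    (2*ρ*γ + 2*ρ) * p 0 0 := by
    linear_combination 2*(1+γ)*h2 + 2*γ*h5 + (1+γ)*h3
  have e2 : (-ρ*k) * p 1 0 + (ρ + 2) * p 0 2 = (2*ρ*k) * p 0 0 := by
    linear_combination 2*h4 + h3
  have e3 : (-ρ) * p 1 0 + (ρ*γ + γ^2 + γ) * p 0 1 = 0 := by
    linear_combination (1+γ)*h6 + h5
  obtain ⟨w, hw⟩ : ∃ w : ℝ, w =
      (ρ^2*k + 2*ρ^2 + ρ*k + 5*ρ + 2)*γ + (ρ*k + ρ + 2)*γ^2 := ⟨_, rfl⟩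
  have hw_pos : 0 < w := by
    rw [hw]
    positivity
  have hx : w * p 1 0 =
      ((ρ^3*k + ρ^3 + ρ^2*k + 3*ρ^2 + 2*ρ)*γ + (ρ^2*k + ρ^2 + 2*ρ)*γ^2) * p 0 0 := by
    have hc : 2*(1+γ) ≠ 0 := by positivity
    refine mul_left_cancel₀ hc ?_
    rw [hw]
    linear_combination
      ((ρ^2 + 3*ρ + 2)*γ + (ρ + 2)*γ^2)*e1 + ((ρ^2 + ρ)*γ + (ρ^2 + 2*ρ)*γ^2 + ρ*γ^3)*e2 + ((2*ρ^2
      + 4*ρ)*γ)*e3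
  have hy : w * p 0 2 =
      ((ρ^3*k^2 + ρ^3*k + ρ^2*k^2 + 5*ρ^2*k + 2*ρ*k)*γ + (ρ^2*k^2 + ρ^2*k + 2*ρ*k)*γ^2) * p 0
      0 := by
    have hc : 2*(1+γ) ≠ 0 := by positivity
    refine mul_left_cancel₀ hc ?_
    rw [hw]
    linear_combination
      ((ρ^2*k + ρ*k)*γ + ρ*k*γ^2)*e1 + ((ρ^2*k + ρ*k + 4*ρ + 2)*γ + (ρ^2*k + 2*ρ*k + 4*ρ + 4)*γ^2
      + (ρ*k + 2)*γ^3)*e2 + (2*ρ^2*k*γ)*e3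
  have hu : w * p 0 1 =
      (ρ^3*k + ρ^3 + 2*ρ^2) * p 0 0 := by
    have hc : 2*(1+γ) ≠ 0 := by positivity
    refine mul_left_cancel₀ hc ?_
    rw [hw]
    linear_combination
      (ρ^2 + 2*ρ)*e1 + (ρ^2 + ρ^2*γ)*e2 + (2*ρ^2 + 2*ρ*k + 6*ρ + 4 + (2*ρ*k + 2*ρ + 4)*γ)*e3
  have hthru : 2*(1+γ)*w * Tps ρ k p = 2*(1+γ) * partialThru ρ k γ * p 0 0 := by
    rw [Tps, partialThru]
    linear_combination 2*(1+γ)*((ρ + k*ρ)*hx + ρ*hy + ρ*hu) + 2*(1+γ)*(ρ + k*ρ)*p 0 0*hw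
      - 2*(1+γ)*w*(ρ + k*ρ)*hsum
  have hnorm : 2*(1+γ)*w = 2*(1+γ) * partialNorm ρ k γ * p 0 0 := by
    rw [partialNorm]
    linear_combination 2*w*h5 + (1+γ)*w*h3 - 2*(1+γ)*w*hsum + 2*(1+γ)*p 0 0*hw
      + (2*(1+γ) + 2*ρ + (1+γ)*k*ρ)*hx + (2*(1+γ) + (1+γ)*ρ)*hy + (2*(1+γ) + 2*ρ)*hu
  refine mul_left_cancel₀ (show 2*(1+γ)*w ≠ 0 by positivity) ?_
  linear_combination partialNorm ρ k γ * hthru - partialThru ρ k γ * hnorm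

theorem independentGap_mul_sq_lt {ρ k s t : ℝ} (hρ : 0 < ρ) (hk : 0 < k) (hs : 0 < s)
    (hst : s < t) : independentGap ρ k s * t^2 < independentGap ρ k t * s^2 := by
  have h0 : 0 <
      ρ^2*(2*ρ^5*k^5 + 6*ρ^5*k^4 + 6*ρ^5*k^3 + 2*ρ^5*k^2 + ρ^4*k^5 + 8*ρ^4*k^4 + 6*ρ^4*k^3 +
      8*ρ^4*k^2 + ρ^4*k + 2*ρ^3*k^4 + 2*ρ^3*k^3 + 2*ρ^3*k^2 + 2*ρ^3*k) := by
    positivity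
  have h1 : 0 ≤
      ρ^2*(ρ^5*k^6 + 3*ρ^5*k^5 + 4*ρ^5*k^4 + 4*ρ^5*k^3 + 3*ρ^5*k^2 + ρ^5*k + 3*ρ^4*k^5 +
      6*ρ^4*k^4 + 30*ρ^4*k^3 + 6*ρ^4*k^2 + 3*ρ^4*k + 3*ρ^3*k^4 + 17*ρ^3*k^3 + 17*ρ^3*k^2 +
      3*ρ^3*k + 2*ρ^2*k^3 + 4*ρ^2*k^2 + 2*ρ^2*k) := by
    positivity
  obtain ⟨c2, hc2⟩ : ∃ c2 : ℝ, c2 =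
      ρ^2*(2*ρ^5*k^5 + 6*ρ^5*k^4 + 6*ρ^5*k^3 + 2*ρ^5*k^2 + ρ^4*k^6 + 2*ρ^4*k^5 + ρ^4*k^4 +
      24*ρ^4*k^3 + ρ^4*k^2 + 2*ρ^4*k + ρ^4 + 4*ρ^3*k^5 + 2*ρ^3*k^4 + 10*ρ^3*k^3 + 10*ρ^3*k^2 +
      2*ρ^3*k + 4*ρ^3 + 5*ρ^2*k^4 + 14*ρ^2*k^2 + 5*ρ^2 + 2*ρ*k^3 + 2*ρ*k^2 + 2*ρ*k +
      2*ρ) := ⟨_, rfl⟩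
  have h3 : 0 ≤
      ρ^2*(ρ^5*k^6 + 3*ρ^5*k^5 + 4*ρ^5*k^4 + 4*ρ^5*k^3 + 3*ρ^5*k^2 + ρ^5*k + ρ^4*k^6 + 7*ρ^4*k^5
      + 21*ρ^4*k^4 + 22*ρ^4*k^3 + 21*ρ^4*k^2 + 7*ρ^4*k + ρ^4 + 7*ρ^3*k^5 + 26*ρ^3*k^4 +
      39*ρ^3*k^3 + 39*ρ^3*k^2 + 26*ρ^3*k + 7*ρ^3 + 16*ρ^2*k^4 + 34*ρ^2*k^3 + 28*ρ^2*k^2 +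
      34*ρ^2*k + 16*ρ^2 + 14*ρ*k^3 + 14*ρ*k^2 + 14*ρ*k + 14*ρ + 4*k^2 + 4) := by
    positivity
  have h4 : 0 ≤
      ρ^2*(3*ρ^4*k^5 + 6*ρ^4*k^4 + 6*ρ^4*k^3 + 6*ρ^4*k^2 + 3*ρ^4*k + 3*ρ^3*k^5 + 17*ρ^3*k^4 +
      24*ρ^3*k^3 + 24*ρ^3*k^2 + 17*ρ^3*k + 3*ρ^3 + 13*ρ^2*k^4 + 32*ρ^2*k^3 + 30*ρ^2*k^2 +
      32*ρ^2*k + 13*ρ^2 + 18*ρ*k^3 + 18*ρ*k^2 + 18*ρ*k + 18*ρ + 8*k^2 + 8) := by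
    positivity
  have h5 : 0 ≤
      ρ^2*(2*ρ^3*k^4 + 2*ρ^3*k^3 + 2*ρ^3*k^2 + 2*ρ^3*k + 2*ρ^2*k^4 + 8*ρ^2*k^3 + 4*ρ^2*k^2 +
      8*ρ^2*k + 2*ρ^2 + 6*ρ*k^3 + 6*ρ*k^2 + 6*ρ*k + 6*ρ + 4*k^2 + 4) := by
    positivity
  refine mul_sq_lt_mul_sq_of_one_sign_change (c2 := c2) hs hst h0 h1 h3 h4 h5 le_rfl le_rfl
    (fun γ => ?_)
  rw [hc2]
  simp only [independentGap, fullIdle, fullNorm]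
  ring

theorem partialGap_mul_sq_lt {ρ k s t : ℝ} (hρ : 0 < ρ) (hk : 0 < k) (hs : 0 < s)
    (hst : s < t) : partialGap ρ k s * t^2 < partialGap ρ k t * s^2 := by
  have h0 : 0 <
      (ρ^2*k)*(ρ^7*k^4 + 4*ρ^7*k^3 + 6*ρ^7*k^2 + 4*ρ^7*k + ρ^7 + 4*ρ^6*k^3 + 8*ρ^6*k^2 + 8*ρ^6*k
      + 4*ρ^6 + 4*ρ^5*k^2 + 4*ρ^5) := by
    positivity
  have h1 : 0 ≤
      (ρ^2*k)*(2*ρ^7*k^5 + 8*ρ^7*k^4 + 12*ρ^7*k^3 + 8*ρ^7*k^2 + 2*ρ^7*k + 2*ρ^6*k^5 + 20*ρ^6*k^4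
      + 43*ρ^6*k^3 + 53*ρ^6*k^2 + 31*ρ^6*k + 3*ρ^6 + ρ^5*k^5 + 15*ρ^5*k^4 + 52*ρ^5*k^3 +
      52*ρ^5*k^2 + 67*ρ^5*k + 13*ρ^5 + 4*ρ^4*k^4 + 24*ρ^4*k^3 + 24*ρ^4*k^2 + 28*ρ^4*k + 16*ρ^4 +
      4*ρ^3*k^3 + 4*ρ^3*k^2 + 4*ρ^3*k + 4*ρ^3) := by
    positivity
  obtain ⟨c2, hc2⟩ : ∃ c2 : ℝ, c2 =
      (ρ^2*k)*(-ρ^7*k^6 - 4*ρ^7*k^5 - 5*ρ^7*k^4 + 5*ρ^7*k^2 + 4*ρ^7*k + ρ^7 - ρ^6*k^6 -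
      11*ρ^6*k^5 - 27*ρ^6*k^4 - 44*ρ^6*k^3 - 17*ρ^6*k^2 + 15*ρ^6*k + 5*ρ^6 - 6*ρ^5*k^5 -
      31*ρ^5*k^4 - 68*ρ^5*k^3 - 134*ρ^5*k^2 - 10*ρ^5*k + 9*ρ^5 - 13*ρ^4*k^4 - 41*ρ^4*k^3 -
      119*ρ^4*k^2 - 67*ρ^4*k + 8*ρ^4 - 12*ρ^3*k^3 - 32*ρ^3*k^2 - 40*ρ^3*k + 4*ρ^3 - 4*ρ^2*k^2 -
      4*ρ^2*k) := ⟨_, rfl⟩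
  have h3 : 0 ≤
      (ρ^2*k)*(2*ρ^7*k^5 + 8*ρ^7*k^4 + 12*ρ^7*k^3 + 8*ρ^7*k^2 + 2*ρ^7*k + ρ^6*k^5 + 12*ρ^6*k^4 +
      58*ρ^6*k^3 + 72*ρ^6*k^2 + 29*ρ^6*k + 4*ρ^6 + ρ^5*k^6 + 6*ρ^5*k^5 + 13*ρ^5*k^4 + 41*ρ^5*k^3
      + 168*ρ^5*k^2 + 101*ρ^5*k + 22*ρ^5 + 6*ρ^4*k^5 + 22*ρ^4*k^4 + 26*ρ^4*k^3 + 124*ρ^4*k^2 +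
      160*ρ^4*k + 46*ρ^4 + 13*ρ^3*k^4 + 23*ρ^3*k^3 + 41*ρ^3*k^2 + 137*ρ^3*k + 50*ρ^3 + 12*ρ^2*k^3
      + 8*ρ^2*k^2 + 52*ρ^2*k + 32*ρ^2 + 4*ρ*k^2 + 4*ρ*k + 8*ρ) := by
    positivity
  have h4 : 0 ≤
      (ρ^2*k)*(ρ^7*k^6 + 4*ρ^7*k^5 + 6*ρ^7*k^4 + 4*ρ^7*k^3 + ρ^7*k^2 + 2*ρ^6*k^6 + 17*ρ^6*k^5 +
      50*ρ^6*k^4 + 60*ρ^6*k^3 + 32*ρ^6*k^2 + 7*ρ^6*k + 2*ρ^5*k^6 + 24*ρ^5*k^5 + 97*ρ^5*k^4 +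
      205*ρ^5*k^3 + 173*ρ^5*k^2 + 63*ρ^5*k + 4*ρ^5 + 15*ρ^4*k^5 + 101*ρ^4*k^4 + 269*ρ^4*k^3 +
      351*ρ^4*k^2 + 176*ρ^4*k + 24*ρ^4 + 43*ρ^3*k^4 + 189*ρ^3*k^3 + 337*ρ^3*k^2 + 235*ρ^3*k +
      52*ρ^3 + 58*ρ^2*k^3 + 160*ρ^2*k^2 + 166*ρ^2*k + 48*ρ^2 + 36*ρ*k^2 + 52*ρ*k + 16*ρ +
      8*k) := by
    positivity
  have h5 : 0 ≤
      (ρ^2*k)*(ρ^6*k^6 + 7*ρ^6*k^5 + 15*ρ^6*k^4 + 13*ρ^6*k^3 + 4*ρ^6*k^2 + ρ^5*k^6 + 16*ρ^5*k^5 +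
      71*ρ^5*k^4 + 105*ρ^5*k^3 + 60*ρ^5*k^2 + 11*ρ^5*k + 12*ρ^4*k^5 + 98*ρ^4*k^4 + 252*ρ^4*k^3 +
      228*ρ^4*k^2 + 72*ρ^4*k + 2*ρ^4 + 49*ρ^3*k^4 + 251*ρ^3*k^3 + 365*ρ^3*k^2 + 165*ρ^3*k +
      10*ρ^3 + 90*ρ^2*k^3 + 276*ρ^2*k^2 + 186*ρ^2*k + 16*ρ^2 + 76*ρ*k^2 + 108*ρ*k + 8*ρ +
      24*k) := by
    positivity
  have h6 : 0 ≤
      (ρ^2*k)*(3*ρ^5*k^5 + 11*ρ^5*k^4 + 13*ρ^5*k^3 + 5*ρ^5*k^2 + 3*ρ^4*k^5 + 30*ρ^4*k^4 +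
      70*ρ^4*k^3 + 50*ρ^4*k^2 + 7*ρ^4*k + 21*ρ^3*k^4 + 107*ρ^3*k^3 + 143*ρ^3*k^2 + 41*ρ^3*k +
      54*ρ^2*k^3 + 156*ρ^2*k^2 + 86*ρ^2*k + 60*ρ*k^2 + 76*ρ*k + 24*k) := by
    positivity
  have h7 : 0 ≤
      (ρ^2*k)*(2*ρ^4*k^4 + 4*ρ^4*k^3 + 2*ρ^4*k^2 + 2*ρ^3*k^4 + 14*ρ^3*k^3 + 14*ρ^3*k^2 + 2*ρ^3*k
      + 10*ρ^2*k^3 + 28*ρ^2*k^2 + 10*ρ^2*k + 16*ρ*k^2 + 16*ρ*k + 8*k) := by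
    positivity
  refine mul_sq_lt_mul_sq_of_one_sign_change (c2 := c2) hs hst h0 h1 h3 h4 h5 h6 h7 (fun γ => ?_)
  rw [hc2]
  simp only [partialGap, fullIdle, fullNorm, partialNorm, partialThru]
  ring

theorem FullStationary.throughput_sub_independent {ρ k γ : ℝ} (hρ : 0 < ρ) (hk : 0 < k)
    (hγ : 0 < γ) {π : Fin 3 → Fin 3 → ℝ} (h : FullStationary ρ k γ π) :
    (Tfs ρ k π - Tis ρ k) * (fullNorm ρ k γ*((ρ + 1)*(k*ρ + 1))) = independentGap ρ k γ := by
  have hT := h.throughput_mul_norm hρ hk hγ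
  have hI : Tis ρ k*((ρ + 1)*(k*ρ + 1)) = ρ*(k*ρ + 1) + k*ρ*(ρ + 1) := by
    have : k*ρ + 1 ≠ 0 := by positivity
    rw [Tis]
    field_simp
  rw [independentGap]
  linear_combination (ρ + 1)*(k*ρ + 1)*hT - fullNorm ρ k γ*hI

theorem FullStationary.throughput_sub_partial {ρ k γ : ℝ} (hρ : 0 < ρ) (hk : 0 < k)
    (hγ : 0 < γ) {π : Fin 3 → Fin 3 → ℝ} {p : Fin 2 → Fin 3 → ℝ} (h : FullStationary ρ k γ π)
    (hp : PartialStationary ρ k γ p) :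
    (Tfs ρ k π - Tps ρ k p) * (fullNorm ρ k γ*partialNorm ρ k γ) = partialGap ρ k γ := by
  have hT := h.throughput_mul_norm hρ hk hγ
  have hT' := hp.throughput_mul_norm hρ hk hγ
  rw [partialGap]
  linear_combination partialNorm ρ k γ*hT - fullNorm ρ k γ*hT'

/-- for `γ ∈ (γ^b, γ^r)` one has `T_is < T_fs < T_ps`. -/
theorem stmt_17 (ρ k : ℝ) (hρ : 0 < ρ) (hk : k ∈ Set.Ioo (0:ℝ) 1)
    (γb γr : ℝ) (hγb : γb ∈ Set.Ioo (0:ℝ) 1) (hγr : γr ∈ Set.Ioo (0:ℝ) 1)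
    (hb : ∃ πb : Fin 3 → Fin 3 → ℝ, FullStationary ρ k γb πb ∧ Tfs ρ k πb = Tis ρ k)
    (hr : ∃ (πr : Fin 3 → Fin 3 → ℝ) (pr : Fin 2 → Fin 3 → ℝ),
      FullStationary ρ k γr πr ∧ PartialStationary ρ k γr pr ∧ Tfs ρ k πr = Tps ρ k pr)
    (γ : ℝ) (hγ : γb < γ) (hγ' : γ < γr)
    (π : Fin 3 → Fin 3 → ℝ) (p : Fin 2 → Fin 3 → ℝ)
    (hπ : FullStationary ρ k γ π) (hp : PartialStationary ρ k γ p) :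
    Tis ρ k < Tfs ρ k π ∧ Tfs ρ k π < Tps ρ k p := by
  obtain ⟨πb, hπb, hTb⟩ := hb
  obtain ⟨πr, pr, hπr, hpr, hTr⟩ := hr
  have hk0 := hk.1
  have hγb0 := hγb.1
  have hγ0 := hγb0.trans hγ
  have hγr0 := hγr.1
  have hN := fullNorm_pos hρ hk0 hγ0
  have hN' := partialNorm_pos hρ hk0 hγ0
  constructor
  · have hzero := hπb.throughput_sub_independent hρ hk0 hγb0
    rw [sub_eq_zero.2 hTb, zero_mul] at hzero
    have hlt := independentGap_mul_sq_lt hρ hk0 hγb0 hγ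
    rw [← hzero, zero_mul, ← hπ.throughput_sub_independent hρ hk0 hγ0] at hlt
    have hpos := pos_of_mul_pos_left hlt (by positivity)
    exact sub_pos.1 (pos_of_mul_pos_left hpos (by positivity))
  · have hzero := hπr.throughput_sub_partial hρ hk0 hγr0 hpr
    rw [sub_eq_zero.2 hTr, zero_mul] at hzero
    have hlt := partialGap_mul_sq_lt hρ hk0 hγ0 hγ'
    rw [← hzero, zero_mul, ← hπ.throughput_sub_partial hρ hk0 hγ0 hp] at hlt
    have hneg := neg_of_mul_neg_left hlt (by positivity)
    exact sub_neg.1 (neg_of_mul_neg_left hneg (by positivity))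
end
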